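/- Let λ > 0, let x = (x₁,x₂) ∈ [−π,π)², and let w₁ = (−1,1)ᵀ so that ⟨x,w₁⟩ = x₂ − x₁ and ‖w₁‖² = 2. If |(⟨x,w₁⟩)_{2π}| = π, then the set of minimizers over y ∈ [−π,π)² of (1/2)[dist(x₁,y₁)² + dist(x₂,y₂)²] + λ·|(y₂ − y₁)_{2π}| consists of exactly the two points (x + m₁·w₁)_{2π} and (x − m₁·w₁)_{2π} (applied componentwise), where m₁ := min{λ, π/2}. -/

import Mathlib

open Real Set

/-- `wrap a` is the unique representative of `a` modulo `2π` lying in `[-π, π)`. -/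
noncomputable def wrap (a : ℝ) : ℝ := a - 2 * π * ↑⌊(a + π) / (2 * π)⌋

theorem wrap_mem (a : ℝ) : wrap a ∈ Ico (-π) π := by
  have h2 : 0 < 2 * π := by positivity
  have h₁ := (le_div_iff₀ h2).1 (Int.floor_le ((a + π) / (2 * π)))
  have h₂ := (div_lt_iff₀ h2).1 (Int.lt_floor_add_one ((a + π) / (2 * π)))
  unfold wrap
  constructor <;> linarith

theorem exists_wrap_eq (a : ℝ) : ∃ k : ℤ, wrap a = a + 2 * π * k :=
  ⟨-⌊(a + π) / (2 * π)⌋, by simp only [wrap]; push_cast; ring⟩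

theorem wrap_eq_of_mem {a u : ℝ} (k : ℤ) (hu : u ∈ Ico (-π) π) (h : a = u + 2 * π * k) :
    wrap a = u := by
  have h2 : 0 < 2 * π := by positivity
  have hk : ⌊(a + π) / (2 * π)⌋ = k := by
    rw [Int.floor_eq_iff, le_div_iff₀ h2, div_lt_iff₀ h2]
    constructor <;> linarith [hu.1, hu.2]
  rw [wrap, hk, h]
  ring

theorem abs_wrap_eq_of_abs_le {a u : ℝ} (k : ℤ) (hu : |u| ≤ π) (h : a = u + 2 * π * k) :
    |wrap a| = |u| := by
  obtain ⟨h₁, h₂⟩ := abs_le.1 hu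
  rcases h₂.lt_or_eq with h₂ | rfl
  · rw [wrap_eq_of_mem k ⟨h₁, h₂⟩ h]
  · rw [wrap_eq_of_mem (u := -π) (k + 1) ⟨le_rfl, by linarith [pi_pos]⟩
      (by rw [h]; push_cast; ring), abs_neg]

theorem abs_wrap_eq_abs_pi_sub_abs {c t : ℝ} (k : ℤ) (ht : |t| ≤ 2 * π)
    (h : c = π + t + 2 * π * k) : |wrap c| = |π - (|t|)| := by
  have hu : |π - (|t|)| ≤ π := abs_le.2 ⟨by linarith, by linarith [abs_nonneg t]⟩
  rcases le_total 0 t with h0 | h0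
  · rw [abs_of_nonneg h0] at hu ⊢
    rw [abs_sub_comm] at hu ⊢
    exact abs_wrap_eq_of_abs_le (k + 1) hu (by rw [h]; push_cast; ring)
  · rw [abs_of_nonpos h0] at hu ⊢
    exact abs_wrap_eq_of_abs_le k hu (by rw [h]; ring)

theorem wrap_sub_eq_iff {x y c : ℝ} (hy : y ∈ Ico (-π) π) (hc : c ∈ Ico (-π) π) :
    wrap (x - y) = c ↔ y = wrap (x - c) := by
  constructor
  · intro h
    obtain ⟨k, hk⟩ := exists_wrap_eq (x - y)
    exact (wrap_eq_of_mem (-k) hy (by push_cast; linarith)).symm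
  · intro h
    obtain ⟨k, hk⟩ := exists_wrap_eq (x - c)
    exact wrap_eq_of_mem (-k) hc (by push_cast; linarith)

/-- The minimum of `s ↦ s ^ 2 / 4 + lam * |π - s|`, attained only at `s = 2 * min lam (π / 2)`. -/
theorem quarter_sq_add_sq_le {lam s : ℝ} (hlam : 0 < lam) :
    min lam (π / 2) ^ 2 + lam * (π - 2 * min lam (π / 2)) + (s / 2 - min lam (π / 2)) ^ 2 ≤
      s ^ 2 / 4 + lam * |π - s| := by
  rcases le_total lam (π / 2) with h | h
  · rw [min_eq_left h]
    nlinarith [le_abs_self (π - s)]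
  · rw [min_eq_right h]
    have := mul_le_mul_of_nonneg_right h (abs_nonneg (π - s))
    nlinarith [le_abs_self (π - s), pi_pos]

/-- prox of the first-order cyclic difference on S¹, boundary case
|(⟨x,w₁⟩)_{2π}| = π: the set of minimizers over y ∈ [−π,π)² of
(1/2)(dist(x₁,y₁)² + dist(x₂,y₂)²) + λ|(y₂−y₁)_{2π}| consists of exactly the
two points (x ± m₁·w₁)_{2π}, w₁ = (−1,1), m₁ = min{λ, π/2}. -/
theorem stmt9 (lam : ℝ) (hlam : 0 < lam) (x₁ x₂ : ℝ)
    (hx₁ : x₁ ∈ Ico (-π) π) (hx₂ : x₂ ∈ Ico (-π) π)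
    (d m q₁ q₂ r₁ r₂ : ℝ)
    (hd : d = wrap (x₂ - x₁))
    (hdeq : |d| = π)
    (hm : m = min lam (π / 2))
    (hq₁ : q₁ = wrap (x₁ - m)) (hq₂ : q₂ = wrap (x₂ + m))
    (hr₁ : r₁ = wrap (x₁ + m)) (hr₂ : r₂ = wrap (x₂ - m))
    (F : ℝ → ℝ → ℝ)
    (hF : ∀ y₁ y₂ : ℝ, F y₁ y₂ =
      (1 / 2) * (|wrap (x₁ - y₁)| ^ 2 + |wrap (x₂ - y₂)| ^ 2) +
        lam * |wrap (y₂ - y₁)|) :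
    (q₁, q₂) ≠ (r₁, r₂) ∧
    q₁ ∈ Ico (-π) π ∧ q₂ ∈ Ico (-π) π ∧ r₁ ∈ Ico (-π) π ∧ r₂ ∈ Ico (-π) π ∧
    (∀ y₁ ∈ Ico (-π) π, ∀ y₂ ∈ Ico (-π) π,
      ((∀ z₁ ∈ Ico (-π) π, ∀ z₂ ∈ Ico (-π) π, F y₁ y₂ ≤ F z₁ z₂) ↔
        ((y₁ = q₁ ∧ y₂ = q₂) ∨ (y₁ = r₁ ∧ y₂ = r₂)))) := by
  have hpi := pi_pos
  have hm0 : 0 < m := hm ▸ lt_min hlam (by positivity)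
  have hmle : m ≤ π / 2 := hm ▸ min_le_right _ _
  have hmI : m ∈ Ico (-π) π := ⟨by linarith, by linarith⟩
  have hnmI : -m ∈ Ico (-π) π := ⟨by linarith, by linarith⟩
  have hq₁I : q₁ ∈ Ico (-π) π := hq₁ ▸ wrap_mem _
  have hq₂I : q₂ ∈ Ico (-π) π := hq₂ ▸ wrap_mem _
  have hr₁I : r₁ ∈ Ico (-π) π := hr₁ ▸ wrap_mem _
  have hr₂I : r₂ ∈ Ico (-π) π := hr₂ ▸ wrap_mem _
  have hq : ∀ y₁ ∈ Ico (-π) π, ∀ y₂ ∈ Ico (-π) π,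
      (y₁ = q₁ ∧ y₂ = q₂ ↔ wrap (x₁ - y₁) = m ∧ wrap (x₂ - y₂) = -m) := by
    intro y₁ h₁ y₂ h₂
    rw [wrap_sub_eq_iff h₁ hmI, wrap_sub_eq_iff h₂ hnmI, sub_neg_eq_add, hq₁, hq₂]
  have hr : ∀ y₁ ∈ Ico (-π) π, ∀ y₂ ∈ Ico (-π) π,
      (y₁ = r₁ ∧ y₂ = r₂ ↔ wrap (x₁ - y₁) = -m ∧ wrap (x₂ - y₂) = m) := by
    intro y₁ h₁ y₂ h₂
    rw [wrap_sub_eq_iff h₁ hnmI, wrap_sub_eq_iff h₂ hmI, sub_neg_eq_add, hr₁, hr₂]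
  obtain ⟨k, hk⟩ : ∃ k : ℤ, x₂ - x₁ = π + 2 * π * k := by
    obtain ⟨k, hk⟩ := exists_wrap_eq (x₂ - x₁)
    rcases eq_or_eq_neg_of_abs_eq hdeq with h | h
    · exact ⟨-k, by push_cast; linarith⟩
    · exact ⟨-k - 1, by push_cast; linarith⟩
  have hF' : ∀ y₁ y₂ : ℝ, F y₁ y₂ =
      (1 / 2) * (wrap (x₁ - y₁) ^ 2 + wrap (x₂ - y₂) ^ 2) +
        lam * |π - (|wrap (x₁ - y₁) - wrap (x₂ - y₂)|)| := by
    intro y₁ y₂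
    obtain ⟨i, hi⟩ := exists_wrap_eq (x₁ - y₁)
    obtain ⟨j, hj⟩ := exists_wrap_eq (x₂ - y₂)
    have ha := wrap_mem (x₁ - y₁)
    have hb := wrap_mem (x₂ - y₂)
    rw [hF, sq_abs, sq_abs, abs_wrap_eq_abs_pi_sub_abs
      (t := wrap (x₁ - y₁) - wrap (x₂ - y₂)) (k - i + j)
      (abs_le.2 ⟨by linarith [ha.1, hb.2], by linarith [ha.2, hb.1]⟩)
      (by push_cast; linarith)]
  set V := m ^ 2 + lam * (π - 2 * m) with hV
  have hle : ∀ y₁ y₂ : ℝ, V + (|wrap (x₁ - y₁) - wrap (x₂ - y₂)| / 2 - m) ^ 2 +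
      (wrap (x₁ - y₁) + wrap (x₂ - y₂)) ^ 2 / 4 ≤ F y₁ y₂ := by
    intro y₁ y₂
    have h := quarter_sq_add_sq_le (s := |wrap (x₁ - y₁) - wrap (x₂ - y₂)|) hlam
    rw [← hm, sq_abs] at h
    rw [hF']
    linarith
  have hmin : ∀ y₁ ∈ Ico (-π) π, ∀ y₂ ∈ Ico (-π) π,
      (y₁ = q₁ ∧ y₂ = q₂) ∨ (y₁ = r₁ ∧ y₂ = r₂) → F y₁ y₂ = V := by
    intro y₁ h₁ y₂ h₂ h
    rw [hq y₁ h₁ y₂ h₂, hr y₁ h₁ y₂ h₂] at h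
    have hs : |wrap (x₁ - y₁) - wrap (x₂ - y₂)| = 2 * m := by
      rcases h with ⟨ha, hb⟩ | ⟨ha, hb⟩ <;> rw [ha, hb]
      · rw [abs_of_nonneg (by linarith)]; ring
      · rw [abs_of_nonpos (by linarith)]; ring
    rw [hF', hs, abs_of_nonneg (by linarith : (0 : ℝ) ≤ π - 2 * m)]
    rcases h with ⟨ha, hb⟩ | ⟨ha, hb⟩ <;> rw [ha, hb, hV] <;> ring
  refine ⟨?_, hq₁I, hq₂I, hr₁I, hr₂I, ?_⟩
  · intro h
    obtain ⟨h₁, h₂⟩ := Prod.mk.inj h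
    have ha := ((hq q₁ hq₁I q₂ hq₂I).1 ⟨rfl, rfl⟩).1
    have hb := ((hr q₁ hq₁I q₂ hq₂I).1 ⟨h₁, h₂⟩).1
    linarith
  · intro y₁ h₁ y₂ h₂
    constructor
    · intro h
      have hFV := (h q₁ hq₁I q₂ hq₂I).trans_eq (hmin q₁ hq₁I q₂ hq₂I (.inl ⟨rfl, rfl⟩))
      have hl := hle y₁ y₂
      rw [hq y₁ h₁ y₂ h₂, hr y₁ h₁ y₂ h₂]
      generalize wrap (x₁ - y₁) = a at hl ⊢
      generalize wrap (x₂ - y₂) = b at hl ⊢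
      have hs : |a - b| / 2 - m = 0 :=
        pow_eq_zero_iff two_ne_zero |>.1 (by
          linarith [sq_nonneg (|a - b| / 2 - m), sq_nonneg (a + b)])
      have hab : a + b = 0 :=
        pow_eq_zero_iff two_ne_zero |>.1 (by
          linarith [sq_nonneg (|a - b| / 2 - m), sq_nonneg (a + b)])
      rcases abs_cases (a - b) with ⟨h', _⟩ | ⟨h', _⟩
      · exact .inl ⟨by linarith, by linarith⟩
      · exact .inr ⟨by linarith, by linarith⟩
    · intro h z₁ _ z₂ _
      rw [hmin y₁ h₁ y₂ h₂ h]
      have hl := hle z₁ z₂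
      have hs := sq_nonneg (|wrap (x₁ - z₁) - wrap (x₂ - z₂)| / 2 - m)
      have ht := sq_nonneg (wrap (x₁ - z₁) + wrap (x₂ - z₂))
      linarith
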